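/- arXiv:math/0006115 — 2 statements merged into one kernel-verified Lean document; each statement's English description precedes it below -/
import Mathlib

section
/- For a quandle X, the subgroups Cₙᴰ(X) of Cₙᴿ(X) generated by n-tuples (x₁,…,xₙ) with xᵢ = xᵢ₊₁ for some i are preserved by the boundary maps: ∂ₙ(Cₙᴰ(X)) ⊆ Cₙ₋₁ᴰ(X). -/
/-- The rack boundary map on generators (0-based indexing). -/
def rackD {X : Type*} (op : X → X → X) {m : ℕ} (x : Fin (m + 1) → X) :
    FreeAbelianGroup (Fin m → X) :=
  ∑ i : Fin (m + 1),
    if (i : ℕ) = 0 then 0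
    else ((-1 : ℤ) ^ ((i : ℕ) + 1)) •
      (FreeAbelianGroup.of (x ∘ i.succAbove) -
        FreeAbelianGroup.of (fun (j : Fin m) => if (j : ℕ) < (i : ℕ)
          then op (x (i.succAbove j)) (x i) else x (i.succAbove j)))

namespace RackHomology

/-- The tuple obtained from `x` by deleting the `i`-th entry and acting with it on the entries
to its left. -/
def actDelete {X : Type*} (op : X → X → X) {m : ℕ} (x : Fin (m + 1) → X) (i : Fin (m + 1)) :
    Fin m → X :=
  fun j => if (j : ℕ) < (i : ℕ) then op (x (i.succAbove j)) (x i) else x (i.succAbove j)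

theorem rackD_eq_sum {X : Type*} (op : X → X → X) {m : ℕ} (x : Fin (m + 1) → X) :
    rackD op x = ∑ i : Fin (m + 1), ((-1 : ℤ) ^ ((i : ℕ) + 1)) •
      (FreeAbelianGroup.of (x ∘ i.succAbove) - FreeAbelianGroup.of (actDelete op x i)) := by
  refine Finset.sum_congr rfl fun i _ => ?_
  split_ifs with hi
  · have h : actDelete op x i = x ∘ i.succAbove := by
      funext j
      simp [actDelete, hi]
    rw [h, sub_self, smul_zero]
  · rfl

theorem comp_succAbove_castSucc_eq {X : Type*} {m : ℕ} {x : Fin (m + 2) → X} {k : Fin (m + 1)}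
    (hk : x k.castSucc = x k.succ) : x ∘ k.castSucc.succAbove = x ∘ k.succ.succAbove := by
  funext j
  rcases lt_trichotomy j k with h | rfl | h
  · simp [Fin.succAbove_castSucc_of_lt _ _ h, Fin.succAbove_succ_of_le _ _ h.le]
  · simp [hk]
  · simp [Fin.succAbove_castSucc_of_le _ _ h.le, Fin.succAbove_succ_of_lt _ _ h]

theorem actDelete_castSucc_eq {X : Type*} {op : X → X → X} (hI : ∀ a : X, op a a = a) {m : ℕ}
    {x : Fin (m + 2) → X} {k : Fin (m + 1)} (hk : x k.castSucc = x k.succ) :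
    actDelete op x k.castSucc = actDelete op x k.succ := by
  funext j
  have hj : x (k.castSucc.succAbove j) = x (k.succ.succAbove j) :=
    congrFun (comp_succAbove_castSucc_eq hk) j
  rcases eq_or_ne j k with rfl | h
  · simp [actDelete, hk, hI]
  · have h' : (j : ℕ) < (k : ℕ) + 1 ↔ (j : ℕ) < (k : ℕ) := by
      have := Fin.val_ne_of_ne h
      omega
    simp only [actDelete, Fin.val_castSucc, Fin.val_succ, h', hj, hk]

/-- Deleting an entry outside a pair of equal adjacent entries leaves the pair adjacent, on one
side of the deleted position. -/
theorem exists_adjacent_succAbove {n : ℕ} {k : Fin (n + 1)} {i : Fin (n + 2)}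
    (hi : i ≠ k.castSucc) (hi' : i ≠ k.succ) :
    ∃ l : Fin n, i.succAbove l.castSucc = k.castSucc ∧ i.succAbove l.succ = k.succ ∧
      ((l : ℕ) < (i : ℕ) ↔ (l : ℕ) + 1 < (i : ℕ)) := by
  have h1 : (i : ℕ) ≠ k := fun h => hi (Fin.ext h)
  have h2 : (i : ℕ) ≠ k + 1 := fun h => hi' (Fin.ext (by simpa using h))
  rcases lt_or_gt_of_ne h1 with h | h
  · refine ⟨⟨k - 1, by omega⟩, ?_, ?_, ?_⟩
    · simp only [Fin.ext_iff, Fin.succAbove, Fin.lt_def]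
      split_ifs <;> simp at * <;> omega
    · simp only [Fin.ext_iff, Fin.succAbove, Fin.lt_def]
      split_ifs <;> simp at * <;> omega
    · simp only
      omega
  · refine ⟨⟨k, by omega⟩, ?_, ?_, ?_⟩
    · simp only [Fin.ext_iff, Fin.succAbove, Fin.lt_def]
      split_ifs <;> simp at * <;> omega
    · simp only [Fin.ext_iff, Fin.succAbove, Fin.lt_def]
      split_ifs <;> simp at * <;> omega
    · simp only
      omega

end RackHomology

/-- For a quandle `X`, the boundary of a degenerate tuple (one with
two equal adjacent entries) lies in the subgroup generated by degenerate tuples: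
`∂ₙ(Cₙᴰ(X)) ⊆ Cₙ₋₁ᴰ(X)`. -/
theorem rack_boundary_preserves_degenerate {X : Type*} (op : X → X → X)
    (hI : ∀ a : X, op a a = a)
    (hII : ∀ a b : X, ∃! c : X, op c b = a)
    (hIII : ∀ a b c : X, op (op a b) c = op (op a c) (op b c))
    (n : ℕ) (x : Fin (n + 2) → X)
    (hx : ∃ i : Fin (n + 1), x i.castSucc = x i.succ) :
    rackD op x ∈ AddSubgroup.closure
      {z : FreeAbelianGroup (Fin (n + 1) → X) |
        ∃ y : Fin (n + 1) → X,
          (∃ i : Fin n, y i.castSucc = y i.succ) ∧ z = FreeAbelianGroup.of y} := by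
  obtain ⟨k, hk⟩ := hx
  rw [RackHomology.rackD_eq_sum, ← Finset.add_sum_erase _ _ (Finset.mem_univ k.castSucc),
    ← Finset.add_sum_erase _ _
      (Finset.mem_erase.2 ⟨(Fin.castSucc_lt_succ (i := k)).ne', Finset.mem_univ k.succ⟩),
    ← add_assoc, RackHomology.comp_succAbove_castSucc_eq hk,
    RackHomology.actDelete_castSucc_eq hI hk, ← add_smul]
  have hsign : (-1 : ℤ) ^ ((k.castSucc : ℕ) + 1) + (-1) ^ ((k.succ : ℕ) + 1) = 0 := by
    simp only [Fin.val_castSucc, Fin.val_succ]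
    ring
  rw [hsign, zero_smul, zero_add]
  refine AddSubgroup.sum_mem _ fun i hi => AddSubgroup.zsmul_mem _ ?_ _
  simp only [Finset.mem_erase, Finset.mem_univ, and_true] at hi
  obtain ⟨l, hl, hl', hlt⟩ := RackHomology.exists_adjacent_succAbove hi.2 hi.1
  refine AddSubgroup.sub_mem _ (AddSubgroup.subset_closure ⟨_, ⟨l, ?_⟩, rfl⟩)
    (AddSubgroup.subset_closure ⟨_, ⟨l, ?_⟩, rfl⟩)
  · simp only [Function.comp_apply, hl, hl', hk]
  · simp only [RackHomology.actDelete, Fin.val_castSucc, Fin.val_succ, hl, hl', hk, hlt]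
end

section
/- The second quandle homology group of the dihedral quandle R₃ with integer coefficients is trivial: H₂ᵠ(R₃; Z) = 0. -/
/-- The dihedral quandle operation on `R₃ = ZMod 3`: `i*j = 2j - i`. -/
def dih3 : ZMod 3 → ZMod 3 → ZMod 3 := fun i j => 2 * j - i

/-- The rack boundary of a 2-chain: `∂₂(x₁,x₂) = (x₁) - (x₁*x₂)`. -/
def d2 (p : ZMod 3 × ZMod 3) : FreeAbelianGroup (ZMod 3) :=
  FreeAbelianGroup.of p.1 - FreeAbelianGroup.of (dih3 p.1 p.2)

/-- The rack boundary of a 3-chain: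
`∂₃(x₁,x₂,x₃) = (x₁,x₃) - (x₁*x₂,x₃) - (x₁,x₂) + (x₁*x₃,x₂*x₃)`. -/
def d3 (t : ZMod 3 × ZMod 3 × ZMod 3) : FreeAbelianGroup (ZMod 3 × ZMod 3) :=
  FreeAbelianGroup.of (t.1, t.2.2) - FreeAbelianGroup.of (dih3 t.1 t.2.1, t.2.2) -
    FreeAbelianGroup.of (t.1, t.2.1) +
    FreeAbelianGroup.of (dih3 t.1 t.2.2, dih3 t.2.1 t.2.2)

/-- A homomorphism on 2-chains which kills degenerate chains and boundaries factors
through `∂₂`. -/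
theorem eq_lift_comp_d2 {M : Type*} [AddCommGroup M]
    (q : FreeAbelianGroup (ZMod 3 × ZMod 3) →+ M)
    (hdeg : ∀ x, q (FreeAbelianGroup.of (x, x)) = 0) (hbd : ∀ t, q (d3 t) = 0)
    (c : FreeAbelianGroup (ZMod 3 × ZMod 3)) :
    q c = FreeAbelianGroup.lift (fun i => -q (FreeAbelianGroup.of (0, 2 * i)))
      (FreeAbelianGroup.lift d2 c) := by
  have hrel : ∀ a b : ZMod 3, q (FreeAbelianGroup.of (a, b)) =
      q (FreeAbelianGroup.of (a, dih3 a b)) + q (FreeAbelianGroup.of (b, a)) := by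
    intro a b
    have h1 : dih3 a (dih3 a b) = b := by revert a b; decide
    have h2 : dih3 b (dih3 a b) = a := by clear h1; revert a b; decide
    have h := hbd (a, b, dih3 a b)
    simp only [d3, map_add, map_sub, hdeg, h1, h2, sub_zero] at h
    rw [← sub_eq_zero, ← neg_eq_zero, ← h]
    abel
  suffices h : q = (FreeAbelianGroup.lift fun i => -q (FreeAbelianGroup.of (0, 2 * i))).comp
      (FreeAbelianGroup.lift d2) from DFunLike.congr_fun h c
  ext ⟨a, b⟩
  simp only [AddMonoidHom.comp_apply, FreeAbelianGroup.lift_apply_of, d2, map_sub]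
  have h01 : q (FreeAbelianGroup.of (0, 1)) =
    q (FreeAbelianGroup.of (0, 2)) + q (FreeAbelianGroup.of (1, 0)) := hrel 0 1
  have h02 : q (FreeAbelianGroup.of (0, 2)) =
    q (FreeAbelianGroup.of (0, 1)) + q (FreeAbelianGroup.of (2, 0)) := hrel 0 2
  have h10 : q (FreeAbelianGroup.of (1, 0)) =
    q (FreeAbelianGroup.of (1, 2)) + q (FreeAbelianGroup.of (0, 1)) := hrel 1 0
  have h12 : q (FreeAbelianGroup.of (1, 2)) =
    q (FreeAbelianGroup.of (1, 0)) + q (FreeAbelianGroup.of (2, 1)) := hrel 1 2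
  have h00 := hdeg 0
  have h11 := hdeg 1
  have h22 := hdeg 2
  have h_four : (2 : ZMod 3) * 2 = 1 := rfl
  have hd : dih3 0 0 = 0 ∧ dih3 0 1 = 2 ∧ dih3 0 2 = 1 ∧ dih3 1 0 = 2 ∧ dih3 1 1 = 1 ∧
      dih3 1 2 = 0 ∧ dih3 2 0 = 1 ∧ dih3 2 1 = 0 ∧ dih3 2 2 = 2 := by decide
  have hZ : ∀ x : ZMod 3, x = 0 ∨ x = 1 ∨ x = 2 := by decide
  clear hrel hdeg hbd
  rcases hZ a with rfl | rfl | rfl <;> rcases hZ b with rfl | rfl | rfl <;>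
    simp only [hd, h_four, mul_zero, mul_one] <;> grind

/-- `H₂ᵠ(R₃; ℤ) = 0`: every quandle 2-cycle of `R₃` is a quandle
2-boundary, i.e. every `c ∈ C₂ᴿ` with `∂₂ c = 0` (note `C₁ᴰ = 0`) differs from a
rack boundary `∂₃ w` by a degenerate chain. -/
theorem H2Q_R3_trivial :
    ∀ c : FreeAbelianGroup (ZMod 3 × ZMod 3),
      FreeAbelianGroup.lift d2 c = 0 →
      ∃ w : FreeAbelianGroup (ZMod 3 × ZMod 3 × ZMod 3),
        c - FreeAbelianGroup.lift d3 w ∈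
          AddSubgroup.closure
            {z : FreeAbelianGroup (ZMod 3 × ZMod 3) |
              ∃ x : ZMod 3, z = FreeAbelianGroup.of (x, x)} := by
  intro c hc
  set D := AddSubgroup.closure {z : FreeAbelianGroup (ZMod 3 × ZMod 3) |
    ∃ x : ZMod 3, z = FreeAbelianGroup.of (x, x)}
  set S := (FreeAbelianGroup.lift d3).range ⊔ D
  have hS : c ∈ S := by
    rw [← QuotientAddGroup.eq_zero_iff, ← QuotientAddGroup.mk'_apply,
      eq_lift_comp_d2 (QuotientAddGroup.mk' S) _ _ c, hc, map_zero]
    · intro x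
      exact (QuotientAddGroup.eq_zero_iff _).2
        (le_sup_right (a := (FreeAbelianGroup.lift d3).range)
          (AddSubgroup.subset_closure ⟨x, rfl⟩))
    · intro t
      exact (QuotientAddGroup.eq_zero_iff _).2
        (le_sup_left (b := D) ⟨FreeAbelianGroup.of t, FreeAbelianGroup.lift_apply_of _ _⟩)
  obtain ⟨_, ⟨w, rfl⟩, z, hz, hsum⟩ := AddSubgroup.mem_sup.1 hS
  exact ⟨w, by rwa [← hsum, add_sub_cancel_left]⟩
end
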